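/- Let G be a vertex-weighted graph with a degree-2 vertex v whose two neighbors u₁ and u₂ are non-adjacent and satisfy w(u₁)+w(u₂) > w(v) ≥ max{w(u₁),w(u₂)}. Let G' be the graph obtained from G by deleting {v,u₁,u₂} and introducing a new vertex v' of weight w(u₁)+w(u₂)−w(v) adjacent to every vertex of N({v,u₁,u₂}). Then α(G) = α(G') + w(v). -/

import Mathlib

open scoped Classical

namespace MWIS

variable {V : Type*}

/-- A finset of vertices is an independent set of `G`. -/
def IsIndepSet (G : SimpleGraph V) (s : Finset V) : Prop :=
  ∀ ⦃a⦄, a ∈ s → ∀ ⦃b⦄, b ∈ s → ¬G.Adj a b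

/-- The maximum total weight of an independent set of `G` contained in `A`
(i.e. α of the induced subgraph `G[A]`, with the inherited weights). -/
noncomputable def alphaOn [Fintype V] (G : SimpleGraph V) (w : V → ℝ) (A : Finset V) : ℝ :=
  sSup {x : ℝ | ∃ s : Finset V, s ⊆ A ∧ IsIndepSet G s ∧ x = ∑ v ∈ s, w v}

/-- The maximum total weight of an independent set of `G`. -/
noncomputable def alpha [Fintype V] (G : SimpleGraph V) (w : V → ℝ) : ℝ :=
  alphaOn G w Finset.univ

/-- The open neighborhood of a vertex, as a finset. -/
noncomputable def nbrs [Fintype V] (G : SimpleGraph V) (v : V) : Finset V :=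
  Finset.univ.filter fun u => G.Adj v u

/-- The degree of a vertex. -/
noncomputable def deg [Fintype V] (G : SimpleGraph V) (v : V) : ℕ :=
  (nbrs G v).card

/-- The closed neighborhood `N[v]` of a vertex. -/
noncomputable def closedNbrs [Fintype V] [DecidableEq V] (G : SimpleGraph V) (v : V) : Finset V :=
  insert v (nbrs G v)

/-- The open neighborhood `N(A)` of a vertex set. -/
noncomputable def openNbhd [Fintype V] [DecidableEq V] (G : SimpleGraph V) (A : Finset V) :
    Finset V :=
  (A.biUnion fun v => nbrs G v) \ A

/-- The closed neighborhood `N[A]` of a vertex set. -/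
noncomputable def closedNbhd [Fintype V] [DecidableEq V] (G : SimpleGraph V) (A : Finset V) :
    Finset V :=
  A ∪ A.biUnion fun v => nbrs G v

/-- `s` is a maximum weighted independent set of `G` with weights `w`. -/
def IsMWIS [Fintype V] (G : SimpleGraph V) (w : V → ℝ) (s : Finset V) : Prop :=
  IsIndepSet G s ∧ ∀ t : Finset V, IsIndepSet G t → ∑ v ∈ t, w v ≤ ∑ v ∈ s, w v

/-- `A` is the vertex set of a connected component of the subgraph of `G` induced on `B`:
`A` is the set of vertices reachable from some `x ∈ B` by paths staying inside `B`. -/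
def IsCompOf (G : SimpleGraph V) (B A : Finset V) : Prop :=
  ∃ x ∈ B, ∀ y, y ∈ A ↔ Relation.ReflTransGen (fun a b => a ∈ B ∧ b ∈ B ∧ G.Adj a b) x y

theorem sum_le_alphaOn [Fintype V] {G : SimpleGraph V} {w : V → ℝ} {A s : Finset V}
    (hsA : s ⊆ A) (hs : IsIndepSet G s) : ∑ v ∈ s, w v ≤ alphaOn G w A := by
  refine le_csSup ?_ ⟨s, hsA, hs, rfl⟩
  refine ((Set.finite_range fun s : Finset V => ∑ v ∈ s, w v).subset ?_).bddAbove
  rintro x ⟨t, -, -, rfl⟩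
  exact ⟨t, rfl⟩

theorem alphaOn_le [Fintype V] {G : SimpleGraph V} {w : V → ℝ} {A : Finset V} {b : ℝ}
    (h : ∀ s ⊆ A, IsIndepSet G s → ∑ v ∈ s, w v ≤ b) : alphaOn G w A ≤ b := by
  refine csSup_le ⟨_, ∅, by simp, by simp [IsIndepSet], rfl⟩ ?_
  rintro x ⟨s, hsA, hs, rfl⟩
  exact h s hsA hs

theorem IsIndepSet.insert [DecidableEq V] {G : SimpleGraph V} {s : Finset V} {a : V}
    (hs : IsIndepSet G s) (ha : ∀ b ∈ s, ¬G.Adj a b) : IsIndepSet G (insert a s) := by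
  intro x hx y hy hxy
  rcases Finset.mem_insert.1 hx with rfl | hxs <;> rcases Finset.mem_insert.1 hy with rfl | hys
  · exact G.irrefl hxy
  · exact ha _ hys hxy
  · exact ha _ hxs hxy.symm
  · exact hs hxs hys hxy

/-- folding a degree-2 vertex `v` with non-adjacent neighbors `u₁, u₂`
satisfying `w(u₁) + w(u₂) > w(v) ≥ max{w(u₁), w(u₂)}`: delete `{v, u₁, u₂}` and
introduce a new vertex (modelled by reusing the label `v`) of weight
`w(u₁) + w(u₂) − w(v)` adjacent to every vertex of `N({v, u₁, u₂})`.
Then `α(G) = α(G') + w(v)`. -/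
theorem stmt5 [Fintype V] [DecidableEq V] (G : SimpleGraph V) (w : V → ℝ)
    (hw : ∀ x, 0 < w x) (v u₁ u₂ : V) (hne : u₁ ≠ u₂)
    (hdeg : deg G v = 2) (hnbrs : nbrs G v = {u₁, u₂}) (hnadj : ¬G.Adj u₁ u₂)
    (hsum : w v < w u₁ + w u₂) (hmax : max (w u₁) (w u₂) ≤ w v) :
    alpha G w =
      alphaOn
        (SimpleGraph.fromRel fun x y =>
          (x = v ∧ y ∈ openNbhd G {v, u₁, u₂}) ∨
          (x ∉ ({v, u₁, u₂} : Finset V) ∧ y ∉ ({v, u₁, u₂} : Finset V) ∧ G.Adj x y))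
        (Function.update w v (w u₁ + w u₂ - w v))
        (Finset.univ \ {u₁, u₂}) + w v := by
  have hv (x : V) : G.Adj v x ↔ x = u₁ ∨ x = u₂ := by
    simpa [nbrs] using Finset.ext_iff.1 hnbrs x
  have hv₁ : v ≠ u₁ := ((hv u₁).2 (.inl rfl)).ne
  have hv₂ : v ≠ u₂ := ((hv u₂).2 (.inr rfl)).ne
  obtain ⟨hw₁, hw₂⟩ := max_le_iff.1 hmax
  set G' : SimpleGraph V := SimpleGraph.fromRel fun x y =>
    (x = v ∧ y ∈ openNbhd G {v, u₁, u₂}) ∨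
    (x ∉ ({v, u₁, u₂} : Finset V) ∧ y ∉ ({v, u₁, u₂} : Finset V) ∧ G.Adj x y) with hG'
  set w' := Function.update w v (w u₁ + w u₂ - w v) with hw'
  have adj_rest {x y : V} (hx : x ∉ ({v, u₁, u₂} : Finset V))
      (hy : y ∉ ({v, u₁, u₂} : Finset V)) : G'.Adj x y ↔ G.Adj x y := by
    have hxv : x ≠ v := fun h => hx (by simp [h])
    have hyv : y ≠ v := fun h => hy (by simp [h])
    simp only [hG', SimpleGraph.fromRel_adj, hxv, hyv, hx, hy, G.adj_comm y x]
    simpa using fun h : G.Adj x y => h.ne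
  have adj_fold {y : V} (hy : y ∉ ({v, u₁, u₂} : Finset V)) :
      G'.Adj v y ↔ G.Adj u₁ y ∨ G.Adj u₂ y := by
    simp only [Finset.mem_insert, Finset.mem_singleton, not_or] at hy
    simp [hG', openNbhd, nbrs, hy, hv, Ne.symm hy.1]
  have sum_w' {s : Finset V} (hs : v ∉ s) : ∑ x ∈ s, w' x = ∑ x ∈ s, w x :=
    Finset.sum_congr rfl fun x hx => Function.update_of_ne (ne_of_mem_of_not_mem hx hs) _ _
  have w'_v : w' v = w u₁ + w u₂ - w v := Function.update_self ..
  apply le_antisymm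
  · refine alphaOn_le fun s _ hs => ?_
    set R := s \ {v, u₁, u₂} with hR
    have hRT {x : V} (hx : x ∈ R) : x ∉ ({v, u₁, u₂} : Finset V) := (Finset.mem_sdiff.1 hx).2
    have hRs : R ⊆ s := Finset.sdiff_subset
    have hvR : v ∉ R := fun h => hRT h (by simp)
    have hRi : IsIndepSet G' R := fun x hx y hy h =>
      hs (hRs hx) (hRs hy) ((adj_rest (hRT hx) (hRT hy)).1 h)
    by_cases h : u₁ ∈ s ∧ u₂ ∈ s
    · have hvs : v ∉ s := fun hvs => hs hvs h.1 ((hv u₁).2 (.inl rfl))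
      have key := sum_le_alphaOn (w := w') (A := Finset.univ \ {u₁, u₂})
        (s := insert v R) (by intro x; simp [hR]; grind)
        (hRi.insert fun y hy hadj => ((adj_fold (hRT hy)).1 hadj).elim
          (hs h.1 (hRs hy)) (hs h.2 (hRs hy)))
      rw [Finset.sum_insert hvR, sum_w' hvR, w'_v] at key
      have hsR : s = insert u₁ (insert u₂ R) := by ext x; simp [hR]; grind
      have : ∑ x ∈ s, w x = w u₁ + (w u₂ + ∑ x ∈ R, w x) := by
        rw [hsR, Finset.sum_insert (by simp [hR, hne]), Finset.sum_insert (by simp [hR])]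
      linarith
    · have key := sum_le_alphaOn (w := w') (A := Finset.univ \ {u₁, u₂})
        (s := R) (by intro x; simp [hR]) hRi
      rw [sum_w' hvR] at key
      obtain ⟨a, haR, haw, hsa⟩ : ∃ a, a ∉ R ∧ w a ≤ w v ∧ s ⊆ insert a R := by
        have n₁ : v ∈ s → u₁ ∉ s := fun h h₁ => hs h h₁ ((hv u₁).2 (.inl rfl))
        have n₂ : v ∈ s → u₂ ∉ s := fun h h₂ => hs h h₂ ((hv u₂).2 (.inr rfl))
        by_cases h₁ : u₁ ∈ s
        · exact ⟨u₁, by simp [hR], hw₁, by intro x; simp [hR]; grind⟩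
        by_cases h₂ : u₂ ∈ s
        · exact ⟨u₂, by simp [hR], hw₂, by intro x; simp [hR]; grind⟩
        · exact ⟨v, hvR, le_rfl, by intro x; simp [hR]; grind⟩
      have := Finset.sum_le_sum_of_subset_of_nonneg hsa fun x _ _ => (hw x).le
      rw [Finset.sum_insert haR] at this
      linarith
  · rw [← le_sub_iff_add_le]
    refine alphaOn_le fun s hsA hs => ?_
    rw [le_sub_iff_add_le]
    have hs₁ : u₁ ∉ s := fun h => by simpa using hsA h
    have hs₂ : u₂ ∉ s := fun h => by simpa using hsA h
    have hT {x : V} (hx : x ∈ s.erase v) : x ∉ ({v, u₁, u₂} : Finset V) := by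
      simp only [Finset.mem_insert, Finset.mem_singleton]
      grind
    have hi : IsIndepSet G (s.erase v) := fun x hx y hy h =>
      hs (Finset.mem_of_mem_erase hx) (Finset.mem_of_mem_erase hy)
        ((adj_rest (hT hx) (hT hy)).2 h)
    have hve : v ∉ s.erase v := Finset.notMem_erase v s
    by_cases hvs : v ∈ s
    · have hn {y : V} (hy : y ∈ s.erase v) : ¬(G.Adj u₁ y ∨ G.Adj u₂ y) := fun h =>
        hs hvs (Finset.mem_of_mem_erase hy) ((adj_fold (hT hy)).2 h)
      have key := sum_le_alphaOn (w := w) (Finset.subset_univ (insert u₁ (insert u₂ (s.erase v))))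
        ((hi.insert fun y hy h => hn hy (.inr h)).insert fun y hy h => by
          rcases Finset.mem_insert.1 hy with rfl | hy
          · exact hnadj h
          · exact hn hy (.inl h))
      rw [Finset.sum_insert (by simp [hne, hs₁]), Finset.sum_insert (by simp [hs₂])] at key
      rw [← Finset.add_sum_erase s w' hvs, sum_w' hve, w'_v]
      unfold alpha
      linarith
    · rw [Finset.erase_eq_of_notMem hvs] at hi
      have key := sum_le_alphaOn (w := w) (Finset.subset_univ (insert v s))
        (hi.insert fun y hy h => by
          rcases (hv y).1 h with rfl | rfl
          · exact hs₁ hy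
          · exact hs₂ hy)
      rw [Finset.sum_insert hvs] at key
      rw [sum_w' hvs]
      unfold alpha
      linarith

end MWIS
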